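/- arXiv:2408.14272 — 4 statements merged into one kernel-verified Lean document; each statement's English description precedes it below -/
import Mathlib

section
/- Let {K_α} be a Kraus family on ℂ^N and let J be an N×N complex matrix that is an orthogonal projector (J† = J and J² = J). Then J is a conserved quantity of the channel, i.e. Λ†(J) = ∑_α K_α† J K_α = J, if and only if J commutes with every Kraus operator, i.e. J K_α = K_α J for all α. -/
open Matrix

/-- **Conserved orthogonal projectors of a quantum channel.**
Let `{K α}` be a Kraus family on `ℂ^N` (i.e. `∑ α, (K α)ᴴ * K α = 1`) and let `J` be an
orthogonal projector (`Jᴴ = J`, `J * J = J`).  Then `J` is a conserved quantity of the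
channel, `Λ†(J) = ∑ α, (K α)ᴴ * J * K α = J`, if and only if `J` commutes with every
Kraus operator. -/
theorem conserved_projector_iff_commutes
    (N : ℕ) (ι : Type) [Fintype ι]
    (K : ι → Matrix (Fin N) (Fin N) ℂ)
    (hKraus : ∑ α, (K α)ᴴ * K α = 1)
    (J : Matrix (Fin N) (Fin N) ℂ)
    (hHerm : Jᴴ = J) (hProj : J * J = J) :
    (∑ α, (K α)ᴴ * J * K α = J) ↔ (∀ α, J * K α = K α * J) := by
  constructor
  · intro h
    have key : ∑ α, (J * K α - K α * J)ᴴ * (J * K α - K α * J) = 0 := by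
      have e : ∀ α, (J * K α - K α * J)ᴴ * (J * K α - K α * J)
          = (K α)ᴴ * J * K α - ((K α)ᴴ * J * K α) * J - J * ((K α)ᴴ * J * K α)
            + J * ((K α)ᴴ * K α) * J := by
        intro α
        have e1 : (K α)ᴴ * J * (J * K α) = (K α)ᴴ * J * K α := by
          rw [Matrix.mul_assoc, ← Matrix.mul_assoc J J, hProj, ← Matrix.mul_assoc]
        rw [conjTranspose_sub, conjTranspose_mul, conjTranspose_mul, hHerm, sub_mul, mul_sub,
          mul_sub, e1]
        noncomm_ring
      simp only [e, Finset.sum_add_distrib, Finset.sum_sub_distrib, ← Finset.sum_mul,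
        ← Finset.mul_sum, h, hKraus]
      simp [hProj]
    open scoped MatrixOrder ComplexOrder in
    have h0 := (Finset.sum_eq_zero_iff_of_nonneg (fun α _ =>
      (posSemidef_conjTranspose_mul_self (J * K α - K α * J)).nonneg)).1 key
    intro α
    open scoped ComplexOrder in
    exact sub_eq_zero.1 (conjTranspose_mul_self_eq_zero.1 (h0 α (Finset.mem_univ α)))
  · intro h
    have e : ∀ α, (K α)ᴴ * J * K α = (K α)ᴴ * K α * J := by
      intro α
      rw [Matrix.mul_assoc, h α, Matrix.mul_assoc]
    simp only [e, ← Finset.sum_mul, hKraus, Matrix.one_mul]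
end

section
/- For the local amplitude damping channel Λ of Example 1 on ℂ^{2M}, assume additionally q_μ ∈ (0,1) for every μ and |∑_{α=0,1} a_μ^α (a_ν^α)*| < 1 for all μ ≠ ν. Then for every matrix σ^(0) = ∑_{μ,ν} (x_{μν} |μ⟩⟨ν| + y_{μν} |ω_μ⟩⟨ω_ν| + z_{μν} |μ⟩⟨ω_ν| + z̄_{νμ} |ω_μ⟩⟨ν|), the iterates converge: lim_{r→∞} Λ^r(σ^(0)) = ∑_μ (x_{μμ} + y_{μμ}) |μ⟩⟨μ|. In particular every state supported on span{|μ⟩, |ω_μ⟩} with unit trace converges to the pattern |μ⟩⟨μ|, demonstrating the associative property. -/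
open Matrix
open scoped ComplexOrder

/-- `|i⟩⟨j|`-type ket-bra on `ℂ^{2M} = ℂ^M ⊕ ℂ^M`, where `Sum.inl μ` labels the pattern
state `|μ⟩` and `Sum.inr μ` labels the decaying state `|ω_μ⟩`. -/
noncomputable def ketbra (M : ℕ) (i j : Fin M ⊕ Fin M) :
    Matrix (Fin M ⊕ Fin M) (Fin M ⊕ Fin M) ℂ :=
  Matrix.single i j 1

/-- `K₀ = ∑ μ, (a⁰_μ |μ⟩⟨μ| + √(1−q_μ) |ω_μ⟩⟨ω_μ|)`. -/
noncomputable def K₀ (M : ℕ) (q : Fin M → ℝ) (a₀ : Fin M → ℂ) :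
    Matrix (Fin M ⊕ Fin M) (Fin M ⊕ Fin M) ℂ :=
  ∑ μ, (a₀ μ • ketbra M (Sum.inl μ) (Sum.inl μ)
      + (Real.sqrt (1 - q μ) : ℂ) • ketbra M (Sum.inr μ) (Sum.inr μ))

/-- `K₁ = ∑ μ, a¹_μ |μ⟩⟨μ|`. -/
noncomputable def K₁ (M : ℕ) (a₁ : Fin M → ℂ) :
    Matrix (Fin M ⊕ Fin M) (Fin M ⊕ Fin M) ℂ :=
  ∑ μ, a₁ μ • ketbra M (Sum.inl μ) (Sum.inl μ)

/-- `K₂ = ∑ μ, √(q_μ) |μ⟩⟨ω_μ|`. -/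
noncomputable def K₂ (M : ℕ) (q : Fin M → ℝ) :
    Matrix (Fin M ⊕ Fin M) (Fin M ⊕ Fin M) ℂ :=
  ∑ μ, (Real.sqrt (q μ) : ℂ) • ketbra M (Sum.inl μ) (Sum.inr μ)

/-- The local amplitude damping channel `Λ(ρ) = ∑_{α=0}^{2} K_α ρ K_αᴴ`. -/
noncomputable def ampChannel (M : ℕ) (q : Fin M → ℝ) (a₀ a₁ : Fin M → ℂ)
    (ρ : Matrix (Fin M ⊕ Fin M) (Fin M ⊕ Fin M) ℂ) :
    Matrix (Fin M ⊕ Fin M) (Fin M ⊕ Fin M) ℂ :=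
  K₀ M q a₀ * ρ * (K₀ M q a₀)ᴴ + K₁ M a₁ * ρ * (K₁ M a₁)ᴴ + K₂ M q * ρ * (K₂ M q)ᴴ

/-- The matrix `σ = ∑_{μ,ν} (x_{μν} |μ⟩⟨ν| + y_{μν} |ω_μ⟩⟨ω_ν| + z_{μν} |μ⟩⟨ω_ν|
+ z̄_{νμ} |ω_μ⟩⟨ν|)`. -/
noncomputable def sigmaOf (M : ℕ) (x y z : Fin M → Fin M → ℂ) :
    Matrix (Fin M ⊕ Fin M) (Fin M ⊕ Fin M) ℂ :=
  ∑ μ, ∑ ν,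
    (x μ ν • ketbra M (Sum.inl μ) (Sum.inl ν)
     + y μ ν • ketbra M (Sum.inr μ) (Sum.inr ν)
     + z μ ν • ketbra M (Sum.inl μ) (Sum.inr ν)
     + (starRingEnd ℂ) (z ν μ) • ketbra M (Sum.inr μ) (Sum.inl ν))

theorem aux_rec (c t d y : ℂ) (u : ℕ → ℂ) (hc : ‖c‖ < 1) (ht : ‖t‖ < 1)
    (hu : ∀ n, u (n+1) = c * u n + d * (t ^ n * y)) :
    Filter.Tendsto u Filter.atTop (nhds 0) := by
  obtain ⟨r, hr1, hr2, hrc, hrt⟩ : ∃ r : ℝ, r < 1 ∧ 1/2 ≤ r ∧ ‖c‖ ≤ r ∧ ‖t‖ ≤ r :=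
    ⟨max (1/2) (max ‖c‖ ‖t‖), by simp [hc, ht]; norm_num, by simp, by simp, by simp⟩
  have hr0 : 0 ≤ r := by linarith
  set D := ‖d‖ * ‖y‖ with hD
  have hD0 : 0 ≤ D := by positivity
  have hb : ∀ n : ℕ, ‖u n‖ ≤ ‖u 0‖ * r ^ n + 2 * D * (n * r ^ n) := by
    intro n
    induction n with
    | zero => simp
    | succ n ih =>
      have h1 : ‖u (n+1)‖ ≤ r * ‖u n‖ + D * r ^ n := by
        rw [hu]
        refine (norm_add_le _ _).trans ?_
        rw [norm_mul, norm_mul, norm_mul, norm_pow]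
        have h2 : ‖t‖ ^ n ≤ r ^ n := by gcongr
        have h3 : ‖c‖ * ‖u n‖ ≤ r * ‖u n‖ := by gcongr
        have h4 : D * ‖t‖ ^ n ≤ D * r ^ n := by gcongr
        have h5 : ‖d‖ * (‖t‖ ^ n * ‖y‖) = D * ‖t‖ ^ n := by rw [hD]; ring
        linarith
      have h2 : r * ‖u n‖ ≤ r * (‖u 0‖ * r ^ n + 2 * D * (n * r ^ n)) := by gcongr
      have h3 : 0 ≤ D * r ^ n * (2 * r - 1) :=
        mul_nonneg (by positivity) (by linarith)
      push_cast
      rw [pow_succ]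
      nlinarith
  have hlim : Filter.Tendsto (fun n : ℕ => ‖u 0‖ * r ^ n + 2 * D * (n * r ^ n))
      Filter.atTop (nhds 0) := by
    have e1 := (tendsto_pow_atTop_nhds_zero_of_lt_one hr0 hr1).const_mul ‖u 0‖
    have e2 := (tendsto_self_mul_const_pow_of_lt_one hr0 hr1).const_mul (2 * D)
    simpa using e1.add e2
  exact squeeze_zero_norm hb hlim

theorem K₀_eq (M : ℕ) (q : Fin M → ℝ) (a₀ : Fin M → ℂ) :
    K₀ M q a₀ = Matrix.fromBlocks (Matrix.diagonal a₀) 0 0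
      (Matrix.diagonal fun μ => (Real.sqrt (1 - q μ) : ℂ)) := by
  ext i j
  rcases i with i | i <;> rcases j with j | j <;>
    simp [K₀, ketbra, Matrix.sum_apply, Matrix.single_apply, Matrix.diagonal_apply, ite_and] 

theorem K₁_eq (M : ℕ) (a₁ : Fin M → ℂ) :
    K₁ M a₁ = Matrix.fromBlocks (Matrix.diagonal a₁) 0 0 0 := by
  ext i j
  rcases i with i | i <;> rcases j with j | j <;>
    simp [K₁, ketbra, Matrix.sum_apply, Matrix.single_apply, Matrix.diagonal_apply, ite_and] 

theorem K₂_eq (M : ℕ) (q : Fin M → ℝ) :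
    K₂ M q = Matrix.fromBlocks 0 (Matrix.diagonal fun μ => (Real.sqrt (q μ) : ℂ)) 0 0 := by
  ext i j
  rcases i with i | i <;> rcases j with j | j <;>
    simp [K₂, ketbra, Matrix.sum_apply, Matrix.single_apply, Matrix.diagonal_apply, ite_and] 

theorem amp_blocks (M : ℕ) (q : Fin M → ℝ) (a₀ a₁ : Fin M → ℂ)
    (A B C D : Matrix (Fin M) (Fin M) ℂ) :
    ampChannel M q a₀ a₁ (Matrix.fromBlocks A B C D) = Matrix.fromBlocks
      (Matrix.of fun μ ν => (a₀ μ * (starRingEnd ℂ) (a₀ ν) + a₁ μ * (starRingEnd ℂ) (a₁ ν)) * A μ ν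
        + (Real.sqrt (q μ) * Real.sqrt (q ν)) * D μ ν)
      (Matrix.of fun μ ν => a₀ μ * Real.sqrt (1 - q ν) * B μ ν)
      (Matrix.of fun μ ν => Real.sqrt (1 - q μ) * (starRingEnd ℂ) (a₀ ν) * C μ ν)
      (Matrix.of fun μ ν => Real.sqrt (1 - q μ) * Real.sqrt (1 - q ν) * D μ ν) := by
  rw [ampChannel, K₀_eq, K₁_eq, K₂_eq]
  ext i j
  rcases i with i | i <;> rcases j with j | j <;>
    simp [Matrix.fromBlocks_conjTranspose, Matrix.fromBlocks_multiply,
      Matrix.diagonal_conjTranspose] <;> ring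

theorem amp_general
    (M : ℕ) (q : Fin M → ℝ) (a₀ a₁ : Fin M → ℂ)
    (hq0 : ∀ μ, 0 < q μ) (hq1 : ∀ μ, q μ < 1)
    (ha : ∀ μ, ‖a₀ μ‖ ^ 2 + ‖a₁ μ‖ ^ 2 = 1)
    (hcontr : ∀ μ ν, μ ≠ ν →
      ‖a₀ μ * (starRingEnd ℂ) (a₀ ν) + a₁ μ * (starRingEnd ℂ) (a₁ ν)‖ < 1)
    (σ : Matrix (Fin M ⊕ Fin M) (Fin M ⊕ Fin M) ℂ) :
    Filter.Tendsto (fun r => (ampChannel M q a₀ a₁)^[r] σ) Filter.atTop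
      (nhds (∑ μ, (σ (Sum.inl μ) (Sum.inl μ) + σ (Sum.inr μ) (Sum.inr μ)) •
        ketbra M (Sum.inl μ) (Sum.inl μ))) := by
  set S := fun r => (ampChannel M q a₀ a₁)^[r] σ with hS
  have hS0 : S 0 = σ := rfl
  have hstep : ∀ r, S (r+1) = ampChannel M q a₀ a₁ (Matrix.fromBlocks (S r).toBlocks₁₁
      (S r).toBlocks₁₂ (S r).toBlocks₂₁ (S r).toBlocks₂₂) := by
    intro r
    rw [Matrix.fromBlocks_toBlocks, hS]
    exact Function.iterate_succ_apply' _ _ _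
  simp only [amp_blocks] at hstep
  have hll : ∀ r μ ν, S (r+1) (Sum.inl μ) (Sum.inl ν) =
      (a₀ μ * (starRingEnd ℂ) (a₀ ν) + a₁ μ * (starRingEnd ℂ) (a₁ ν)) *
        S r (Sum.inl μ) (Sum.inl ν)
        + (Real.sqrt (q μ) * Real.sqrt (q ν)) * S r (Sum.inr μ) (Sum.inr ν) := by
    intro r μ ν; rw [hstep]; rfl
  have hlr : ∀ r μ ν, S (r+1) (Sum.inl μ) (Sum.inr ν) =
      a₀ μ * Real.sqrt (1 - q ν) * S r (Sum.inl μ) (Sum.inr ν) := by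
    intro r μ ν; rw [hstep]; rfl
  have hrl : ∀ r μ ν, S (r+1) (Sum.inr μ) (Sum.inl ν) =
      Real.sqrt (1 - q μ) * (starRingEnd ℂ) (a₀ ν) * S r (Sum.inr μ) (Sum.inl ν) := by
    intro r μ ν; rw [hstep]; rfl
  have hrr : ∀ r μ ν, S (r+1) (Sum.inr μ) (Sum.inr ν) =
      Real.sqrt (1 - q μ) * Real.sqrt (1 - q ν) * S r (Sum.inr μ) (Sum.inr ν) := by
    intro r μ ν; rw [hstep]; rfl
  have hs1 : ∀ μ, Real.sqrt (1 - q μ) < 1 := by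
    intro μ
    rw [Real.sqrt_lt' one_pos]; linarith [hq0 μ]
  have hs1' : ∀ μ, ‖(Real.sqrt (1 - q μ) : ℂ)‖ < 1 := by
    intro μ
    rw [Complex.norm_real, Real.norm_of_nonneg (Real.sqrt_nonneg _)]; exact hs1 μ
  have ha1 : ∀ μ, ‖a₀ μ‖ ≤ 1 := by
    intro μ
    nlinarith [ha μ, sq_nonneg ‖a₁ μ‖, norm_nonneg (a₀ μ)]
  have hss : ∀ μ ν, ‖(Real.sqrt (1 - q μ) : ℂ) * Real.sqrt (1 - q ν)‖ < 1 := by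
    intro μ ν
    rw [norm_mul]
    exact mul_lt_one_of_nonneg_of_lt_one_left (norm_nonneg _) (hs1' μ) (hs1' ν).le
  have hrrn : ∀ r μ ν, S r (Sum.inr μ) (Sum.inr ν) =
      ((Real.sqrt (1 - q μ) : ℂ) * Real.sqrt (1 - q ν)) ^ r * σ (Sum.inr μ) (Sum.inr ν) := by
    intro r μ ν
    induction r with
    | zero => simp [hS0]
    | succ r ih => rw [hrr, ih]; ring
  have trr : ∀ μ ν, Filter.Tendsto (fun r => S r (Sum.inr μ) (Sum.inr ν)) Filter.atTop
      (nhds 0) := by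
    intro μ ν
    exact aux_rec _ 0 0 0 _ (hss μ ν) (by simp) (fun n => by simp [hrr])
  refine tendsto_pi_nhds.2 fun i => ?_
  refine tendsto_pi_nhds.2 fun j => ?_
  rcases i with μ | μ <;> rcases j with ν | ν
  · by_cases h : μ = ν
    · subst h
      have hcons : ∀ r, S r (Sum.inl μ) (Sum.inl μ) + S r (Sum.inr μ) (Sum.inr μ) =
          σ (Sum.inl μ) (Sum.inl μ) + σ (Sum.inr μ) (Sum.inr μ) := by
        intro r
        induction r with
        | zero => simp [hS0]
        | succ r ih =>
          rw [← ih, hll, hrr]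
          have e1 : (Real.sqrt (q μ) : ℂ) * Real.sqrt (q μ) = q μ := by
            rw [← Complex.ofReal_mul, Real.mul_self_sqrt (hq0 μ).le]
          have e2 : (Real.sqrt (1 - q μ) : ℂ) * Real.sqrt (1 - q μ) = 1 - q μ := by
            rw [← Complex.ofReal_mul, Real.mul_self_sqrt (by linarith [hq1 μ])]; simp
          have e3 : a₀ μ * (starRingEnd ℂ) (a₀ μ) + a₁ μ * (starRingEnd ℂ) (a₁ μ) = 1 := by
            rw [Complex.mul_conj', Complex.mul_conj']
            exact_mod_cast ha μ
          rw [e1, e2, e3]; ring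
      have := (trr μ μ).const_sub (σ (Sum.inl μ) (Sum.inl μ) + σ (Sum.inr μ) (Sum.inr μ))
      convert this using 2 with r
      · rw [← hcons r]; ring
      · simp [ketbra, Matrix.sum_apply, Matrix.single_apply]
    · have := aux_rec _ _ _ _ (fun r => S r (Sum.inl μ) (Sum.inl ν)) (hcontr μ ν h) (hss μ ν)
        (fun n => (hll n μ ν).trans (by rw [hrrn n μ ν]))
      convert this using 2
      have h' : ∀ x, ¬ (x = μ ∧ x = ν) := by rintro x ⟨rfl, h2⟩; exact h h2
      simp [ketbra, Matrix.sum_apply, Matrix.single_apply, h']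
  · have : Filter.Tendsto (fun r => S r (Sum.inl μ) (Sum.inr ν)) Filter.atTop (nhds 0) := by
      refine aux_rec (a₀ μ * Real.sqrt (1 - q ν)) 0 0 0 _ ?_ (by simp) (fun n => by simp [hlr])
      rw [norm_mul]
      exact mul_lt_one_of_nonneg_of_lt_one_right (ha1 μ) (norm_nonneg _) (hs1' ν)
    convert this using 2
    simp [ketbra, Matrix.sum_apply, Matrix.single_apply]
  · have : Filter.Tendsto (fun r => S r (Sum.inr μ) (Sum.inl ν)) Filter.atTop (nhds 0) := by
      refine aux_rec (Real.sqrt (1 - q μ) * (starRingEnd ℂ) (a₀ ν)) 0 0 0 _ ?_ (by simp)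
        (fun n => by simp [hrl])
      rw [norm_mul, RCLike.norm_conj]
      exact mul_lt_one_of_nonneg_of_lt_one_left (norm_nonneg _) (hs1' μ) (ha1 ν)
    convert this using 2
    simp [ketbra, Matrix.sum_apply, Matrix.single_apply]
  · convert trr μ ν using 2
    simp [ketbra, Matrix.sum_apply, Matrix.single_apply]

/-- **Associative convergence of the local amplitude damping channel (Example 1).**
Assuming `q_μ ∈ (0,1)` and `|∑_{α=0,1} a^α_μ (a^α_ν)^*| < 1` for `μ ≠ ν`, every matrix
`σ⁽⁰⁾ = ∑_{μ,ν} (x_{μν}|μ⟩⟨ν| + y_{μν}|ω_μ⟩⟨ω_ν| + z_{μν}|μ⟩⟨ω_ν| + z̄_{νμ}|ω_μ⟩⟨ν|)`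
satisfies `lim_{r→∞} Λ^r(σ⁽⁰⁾) = ∑_μ (x_{μμ} + y_{μμ}) |μ⟩⟨μ|`.  In particular every
state (positive semidefinite, unit trace) supported on `span{|μ⟩, |ω_μ⟩}` converges to
the pattern `|μ⟩⟨μ|`. -/
theorem amplitude_damping_associative_convergence
    (M : ℕ) (q : Fin M → ℝ) (a₀ a₁ : Fin M → ℂ)
    (hq0 : ∀ μ, 0 < q μ) (hq1 : ∀ μ, q μ < 1)
    (ha : ∀ μ, ‖a₀ μ‖ ^ 2 + ‖a₁ μ‖ ^ 2 = 1)
    (hcontr : ∀ μ ν, μ ≠ ν →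
      ‖a₀ μ * (starRingEnd ℂ) (a₀ ν) + a₁ μ * (starRingEnd ℂ) (a₁ ν)‖ < 1) :
    (∀ x y z : Fin M → Fin M → ℂ,
      Filter.Tendsto (fun r => (ampChannel M q a₀ a₁)^[r] (sigmaOf M x y z))
        Filter.atTop
        (nhds (∑ μ, (x μ μ + y μ μ) • ketbra M (Sum.inl μ) (Sum.inl μ))))
    ∧ (∀ μ : Fin M, ∀ σ : Matrix (Fin M ⊕ Fin M) (Fin M ⊕ Fin M) ℂ,
        σ.PosSemidef → σ.trace = 1 →
        (∀ i j, ((i ≠ Sum.inl μ ∧ i ≠ Sum.inr μ) ∨ (j ≠ Sum.inl μ ∧ j ≠ Sum.inr μ)) →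
          σ i j = 0) →
        Filter.Tendsto (fun r => (ampChannel M q a₀ a₁)^[r] σ)
          Filter.atTop (nhds (ketbra M (Sum.inl μ) (Sum.inl μ)))) := by
  refine ⟨fun x y z => ?_, fun μ σ _ htr hsupp => ?_⟩
  · have := amp_general M q a₀ a₁ hq0 hq1 ha hcontr (sigmaOf M x y z)
    convert this using 6 with μ _
    · simp [sigmaOf, ketbra, Matrix.sum_apply, Matrix.single_apply, ite_and]
    · simp [sigmaOf, ketbra, Matrix.sum_apply, Matrix.single_apply, ite_and]
  · have := amp_general M q a₀ a₁ hq0 hq1 ha hcontr σ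
    have h0 : ∀ ν, ν ≠ μ → σ (Sum.inl ν) (Sum.inl ν) = 0 ∧ σ (Sum.inr ν) (Sum.inr ν) = 0 :=
      fun ν h => ⟨hsupp _ _ (by simp [h]), hsupp _ _ (by simp [h])⟩
    have h1 : σ (Sum.inl μ) (Sum.inl μ) + σ (Sum.inr μ) (Sum.inr μ) = 1 := by
      rw [← htr, Matrix.trace, Fintype.sum_sum_type, ← Finset.sum_add_distrib,
        Finset.sum_eq_single μ]
      · rfl
      · intro ν _ h; simp [h0 ν h]
      · simp
    convert this using 2
    rw [Finset.sum_eq_single μ, h1, one_smul]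
    · intro ν _ h; simp [h0 ν h]
    · simp
end

section
/- Let u_j ≥ 0 with ∑_{j=1}^{s} u_j = 1, and let b_{j,x}^α, c_x^α be complex numbers and κ_{xy} complex numbers (j,k ∈ {1,…,s}, x,y ∈ {1,…,d}, α finite) satisfying: (i) the associativity condition ∑_α (b_{k,y}^α)* b_{j,x}^α = κ_{xy} u_j δ_{jk} for all j, k, x, y; and (ii) the CPTP condition ∑_α [∑_j (b_{j,y}^α)* b_{j,x}^α + δ_{xy} |c_x^α|²] = δ_{xy} for all x, y. Then κ_{xy} = δ_{xy} (1 − ∑_α |c_x^α|²). -/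
/-- **Determination of the association rate `κ_{xy}` (Eq. (16)).**
If the cross coefficients `b_{j,x}^α` satisfy the associativity condition
`∑ α, (b_{k,y}^α)^* b_{j,x}^α = κ_{xy} u_j δ_{jk}` for a pattern spectrum `u_j ≥ 0`
with `∑ j, u_j = 1`, together with the CPTP condition
`∑ α, [∑ j, (b_{j,y}^α)^* b_{j,x}^α + δ_{xy} |c_x^α|²] = δ_{xy}`, then
`κ_{xy} = δ_{xy} (1 − ∑ α, |c_x^α|²)`. -/
theorem association_rate_determined
    (s d : ℕ) (ι : Type) [Fintype ι]
    (u : Fin s → ℝ) (hu0 : ∀ j, 0 ≤ u j) (hu1 : ∑ j, u j = 1)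
    (b : ι → Fin s → Fin d → ℂ) (c : ι → Fin d → ℂ)
    (κ : Fin d → Fin d → ℂ)
    (hassoc : ∀ (j k : Fin s) (x y : Fin d),
      ∑ α, (starRingEnd ℂ) (b α k y) * b α j x
        = if j = k then κ x y * (u j : ℂ) else 0)
    (hcptp : ∀ x y : Fin d,
      ∑ α, ((∑ j, (starRingEnd ℂ) (b α j y) * b α j x)
          + if x = y then ((‖c α x‖ : ℂ)) ^ 2 else 0)
        = if x = y then 1 else 0) :
    ∀ x y : Fin d,
      κ x y = if x = y then 1 - ∑ α, ((‖c α x‖ : ℂ)) ^ 2 else 0 := by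
  intro x y
  have hu : ∑ j, (u j : ℂ) = 1 := by exact_mod_cast hu1
  have h := hcptp x y
  have hk : ∑ α, ∑ j, (starRingEnd ℂ) (b α j y) * b α j x = κ x y := by
    rw [Finset.sum_comm]
    have h2 : ∀ j : Fin s, ∑ α, (starRingEnd ℂ) (b α j y) * b α j x = κ x y * (u j : ℂ) := by
      intro j
      rw [hassoc j j x y, if_pos rfl]
    rw [Finset.sum_congr rfl (fun j _ => h2 j), ← Finset.mul_sum, hu, mul_one]
  rw [Finset.sum_add_distrib, hk] at h
  by_cases hxy : x = y
  · simp only [if_pos hxy] at h ⊢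
    exact eq_sub_of_add_eq h
  · simp only [if_neg hxy, Finset.sum_const_zero, add_zero] at h ⊢
    exact h
end

section
/- On ℂ^8 = (ℂ²)^{⊗3} with computational basis |abc⟩ (a,b,c ∈ {0,1}), let H = η[∑_{ω ∈ {000,001,010,100,101,110}} |ω⟩⟨ω| + (|000⟩⟨001| + |000⟩⟨010| + |100⟩⟨101| + |100⟩⟨110| + h.c.)] for η ∈ ℝ, and let the jump operators be F_1 = |001⟩⟨000|, F_2 = |010⟩⟨000|, F_3 = |011⟩⟨001|, F_4 = |011⟩⟨010|, F_5 = |101⟩⟨100|, F_6 = |110⟩⟨100|, F_7 = |111⟩⟨101|, F_8 = |111⟩⟨110|. Then the operator P = σ_z ⊗ I₂ ⊗ I₂ commutes with H and with every F_ℓ; consequently L†(P) = 0 for the adjoint Lindbladian L†(X) = i[H,X] + ∑_ℓ (F_ℓ† X F_ℓ − ½{F_ℓ† F_ℓ, X}), so tr(P ρ) is conserved by the dissipative quantum walk. -/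
open Matrix
open scoped Kronecker

/-- Ket-bra `|abc⟩⟨a'b'c'|` on `ℂ^8 = (ℂ²)^{⊗3}`. -/
noncomputable def kb (i j : Fin 2 × Fin 2 × Fin 2) :
    Matrix (Fin 2 × Fin 2 × Fin 2) (Fin 2 × Fin 2 × Fin 2) ℂ :=
  Matrix.single i j 1

/-- Hamiltonian of the dissipative quantum walk with decoupled basins (`κ = 0`):
`H = η[∑_{ω ∈ {000,001,010,100,101,110}} |ω⟩⟨ω|
  + (|000⟩⟨001| + |000⟩⟨010| + |100⟩⟨101| + |100⟩⟨110| + h.c.)]`. -/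
noncomputable def walkH (η : ℝ) :
    Matrix (Fin 2 × Fin 2 × Fin 2) (Fin 2 × Fin 2 × Fin 2) ℂ :=
  (η : ℂ) • (kb (0,0,0) (0,0,0) + kb (0,0,1) (0,0,1) + kb (0,1,0) (0,1,0)
    + kb (1,0,0) (1,0,0) + kb (1,0,1) (1,0,1) + kb (1,1,0) (1,1,0)
    + (kb (0,0,0) (0,0,1) + kb (0,0,0) (0,1,0) + kb (1,0,0) (1,0,1) + kb (1,0,0) (1,1,0)
      + kb (0,0,1) (0,0,0) + kb (0,1,0) (0,0,0) + kb (1,0,1) (1,0,0) + kb (1,1,0) (1,0,0)))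

/-- Jump operators of the dissipative quantum walk, flipping one bit so as to decrease the
Hamming distance to the nearest pattern (`|011⟩` or `|111⟩`). -/
noncomputable def walkF :
    Fin 8 → Matrix (Fin 2 × Fin 2 × Fin 2) (Fin 2 × Fin 2 × Fin 2) ℂ :=
  ![kb (0,0,1) (0,0,0), kb (0,1,0) (0,0,0), kb (0,1,1) (0,0,1), kb (0,1,1) (0,1,0),
    kb (1,0,1) (1,0,0), kb (1,1,0) (1,0,0), kb (1,1,1) (1,0,1), kb (1,1,1) (1,1,0)]

/-- The strong symmetry `P = σ_z ⊗ I₂ ⊗ I₂`. -/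
noncomputable def walkP :
    Matrix (Fin 2 × Fin 2 × Fin 2) (Fin 2 × Fin 2 × Fin 2) ℂ :=
  (!![1, 0; 0, -1] : Matrix (Fin 2) (Fin 2) ℂ)
    ⊗ₖ ((1 : Matrix (Fin 2) (Fin 2) ℂ) ⊗ₖ (1 : Matrix (Fin 2) (Fin 2) ℂ))

/-- The adjoint Lindbladian `L†(X) = i[H, X] + ∑ ℓ, (F_ℓᴴ X F_ℓ − ½{F_ℓᴴ F_ℓ, X})`. -/
noncomputable def walkAdjLindbladian (η : ℝ)
    (X : Matrix (Fin 2 × Fin 2 × Fin 2) (Fin 2 × Fin 2 × Fin 2) ℂ) :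
    Matrix (Fin 2 × Fin 2 × Fin 2) (Fin 2 × Fin 2 × Fin 2) ℂ :=
  Complex.I • (walkH η * X - X * walkH η)
    + ∑ ℓ, ((walkF ℓ)ᴴ * X * walkF ℓ
        - (1 / 2 : ℂ) • ((walkF ℓ)ᴴ * walkF ℓ * X + X * ((walkF ℓ)ᴴ * walkF ℓ)))

/-- The Lindbladian `L(ρ) = −i[H, ρ] + ∑ ℓ, (F_ℓ ρ F_ℓᴴ − ½{F_ℓᴴ F_ℓ, ρ})`. -/
noncomputable def walkLindbladian (η : ℝ)
    (ρ : Matrix (Fin 2 × Fin 2 × Fin 2) (Fin 2 × Fin 2 × Fin 2) ℂ) :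
    Matrix (Fin 2 × Fin 2 × Fin 2) (Fin 2 × Fin 2 × Fin 2) ℂ :=
  (-Complex.I) • (walkH η * ρ - ρ * walkH η)
    + ∑ ℓ, (walkF ℓ * ρ * (walkF ℓ)ᴴ
        - (1 / 2 : ℂ) • ((walkF ℓ)ᴴ * walkF ℓ * ρ + ρ * ((walkF ℓ)ᴴ * walkF ℓ)))

theorem walkP_diag : walkP = Matrix.diagonal (fun i => (![1, -1] : Fin 2 → ℂ) i.1) := by
  have h : (!![1, 0; 0, -1] : Matrix (Fin 2) (Fin 2) ℂ) = Matrix.diagonal ![1, -1] := by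
    ext i j
    fin_cases i <;> fin_cases j <;> simp
  unfold walkP
  rw [h, Matrix.one_kronecker_one, ← Matrix.diagonal_one, Matrix.diagonal_kronecker_diagonal]
  simp

theorem walkP_kb (a : Fin 2) (x y : Fin 2 × Fin 2) :
    Commute walkP (kb (a, x) (a, y)) := by
  unfold Commute SemiconjBy
  rw [walkP_diag]
  ext i j
  rw [Matrix.diagonal_mul, Matrix.mul_diagonal]
  unfold kb
  rw [Matrix.single_apply]
  split_ifs with h
  · obtain ⟨rfl, rfl⟩ := h
    simp
  · simp

theorem walkP_herm : walkPᴴ = walkP := by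
  rw [walkP_diag, Matrix.diagonal_conjTranspose]
  congr 1
  ext i
  obtain ⟨a, b⟩ := i
  fin_cases a <;> simp

theorem walkP_H (η : ℝ) : Commute walkP (walkH η) := by
  unfold walkH
  apply Commute.smul_right
  repeat' apply Commute.add_right
  all_goals apply walkP_kb

theorem walkP_F (l : Fin 8) : Commute walkP (walkF l) := by
  fin_cases l <;> apply walkP_kb

theorem walkP_F_star (l : Fin 8) : Commute walkP (walkF l)ᴴ := by
  have h := congrArg Matrix.conjTranspose (walkP_F l).eq
  rw [Matrix.conjTranspose_mul, Matrix.conjTranspose_mul, walkP_herm] at h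
  exact h.symm

theorem half_smul_self (A : Matrix (Fin 2 × Fin 2 × Fin 2) (Fin 2 × Fin 2 × Fin 2) ℂ) :
    (1 / 2 : ℂ) • (A + A) = A := by
  rw [← two_smul ℂ A, smul_smul]
  norm_num

/-- **Strong symmetry of the dissipative quantum-walk QAM.**
`P = σ_z ⊗ I ⊗ I` commutes with the Hamiltonian and with every jump operator, hence
`L†(P) = 0` and `tr(P · L(ρ)) = 0` for all `ρ`: the quantity `tr(Pρ)` is conserved. -/
theorem walk_strong_symmetry (η : ℝ) :
    (walkP * walkH η = walkH η * walkP)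
    ∧ (∀ ℓ, walkP * walkF ℓ = walkF ℓ * walkP)
    ∧ walkAdjLindbladian η walkP = 0
    ∧ ∀ ρ : Matrix (Fin 2 × Fin 2 × Fin 2) (Fin 2 × Fin 2 × Fin 2) ℂ,
        (walkP * walkLindbladian η ρ).trace = 0 := by
  refine ⟨(walkP_H η).eq, fun l => (walkP_F l).eq, ?_, ?_⟩
  · unfold walkAdjLindbladian
    rw [(walkP_H η).eq, sub_self, smul_zero, zero_add]
    refine Finset.sum_eq_zero fun l _ => ?_
    rw [((walkP_F_star l).mul_right (walkP_F l)).eq, half_smul_self, Matrix.mul_assoc,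
      (walkP_F l).eq, Matrix.mul_assoc, sub_self]
  · intro ρ
    unfold walkLindbladian
    rw [Matrix.mul_add, Matrix.trace_add, Matrix.mul_smul, Matrix.trace_smul, Matrix.mul_sub,
      Matrix.trace_sub, Matrix.mul_sum, Matrix.trace_sum]
    have h1 : (walkP * (walkH η * ρ)).trace = (walkP * (ρ * walkH η)).trace := by
      rw [← Matrix.mul_assoc, (walkP_H η).eq, Matrix.mul_assoc, Matrix.trace_mul_comm,
        Matrix.mul_assoc]
    rw [h1, sub_self, smul_zero, zero_add]
    refine Finset.sum_eq_zero fun l _ => ?_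
    have hc := ((walkP_F_star l).mul_right (walkP_F l)).eq
    have h2 : (walkP * (walkF l * ρ * (walkF l)ᴴ)).trace
        = ((walkF l)ᴴ * walkF l * walkP * ρ).trace := by
      rw [← Matrix.mul_assoc, Matrix.trace_mul_comm, ← Matrix.mul_assoc walkP, (walkP_F l).eq]
      simp only [Matrix.mul_assoc]
    have h3 : (walkP * ((walkF l)ᴴ * walkF l * ρ)).trace
        = ((walkF l)ᴴ * walkF l * walkP * ρ).trace := by
      rw [← Matrix.mul_assoc, hc]
    have h4 : (walkP * (ρ * ((walkF l)ᴴ * walkF l))).trace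
        = ((walkF l)ᴴ * walkF l * walkP * ρ).trace := by
      rw [← Matrix.mul_assoc, Matrix.trace_mul_comm, ← Matrix.mul_assoc]
    rw [Matrix.mul_sub, Matrix.trace_sub, Matrix.mul_smul, Matrix.trace_smul, Matrix.mul_add,
      Matrix.trace_add, h2, h3, h4, smul_eq_mul]
    ring
end
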